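/- arXiv:2102.10723 — 2 statements merged into one kernel-verified Lean document; each statement's English description precedes it below -/
import Mathlib

section
/- Let Γ₁(4) = {(a b; c d) ∈ SL₂(ℤ) : c ≡ 0 (mod 4), d ≡ 1 (mod 4)}. Define v₀ : Γ₁(4) → ℂ^× by v₀((a b; c d)) = (c/d)_*. Then v₀(γ₁)·v₀(γ₂) = c_ℝ(γ₁, γ₂)·v₀(γ₁γ₂) for all γ₁, γ₂ ∈ Γ₁(4); equivalently, (γ, z) ↦ v₀(γ)·J(γ, z) is an automorphy factor on Γ₁(4) × ℍ, so v₀ is a multiplier system of weight 1/2 for Γ₁(4). -/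
open scoped MatrixGroups UpperHalfPlane

open Complex

/-- The automorphy factor `J(g, z)` of half-integral weight (principal branch of
the square root, argument in `(-π, π]`). -/
noncomputable def Jfactor (g : SL(2, ℝ)) (z : ℍ) : ℂ :=
  if (g : Matrix (Fin 2) (Fin 2) ℝ) 1 0 = 0 then
    (if 0 < (g : Matrix (Fin 2) (Fin 2) ℝ) 1 1 then
        (((g : Matrix (Fin 2) (Fin 2) ℝ) 1 1 : ℂ)) ^ (1 / 2 : ℂ)
      else -((((g : Matrix (Fin 2) (Fin 2) ℝ) 1 1 : ℂ)) ^ (1 / 2 : ℂ)))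
  else (((g : Matrix (Fin 2) (Fin 2) ℝ) 1 0 : ℂ) * (z : ℂ)
      + ((g : Matrix (Fin 2) (Fin 2) ℝ) 1 1 : ℂ)) ^ (1 / 2 : ℂ)

/-- `x(g) = c` if `c ≠ 0`, and `x(g) = d` if `c = 0`, for `g = (a b; c d)`. -/
noncomputable def xEntry (g : SL(2, ℝ)) : ℝ :=
  if (g : Matrix (Fin 2) (Fin 2) ℝ) 1 0 ≠ 0 then (g : Matrix (Fin 2) (Fin 2) ℝ) 1 0
  else (g : Matrix (Fin 2) (Fin 2) ℝ) 1 1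

/-- The real quadratic Hilbert symbol `⟨a, b⟩_ℝ`. -/
noncomputable def hilbertR (a b : ℝ) : ℝ := if a < 0 ∧ b < 0 then -1 else 1

/-- The Kubota 2-cocycle on `SL₂(ℝ)`. -/
noncomputable def kubotaR (g h : SL(2, ℝ)) : ℝ :=
  hilbertR (xEntry g * xEntry (g * h)) (xEntry h * xEntry (g * h))

/-- The extended Jacobi symbol `(c/d)_* = t(c, d) · (c/|d|)` for odd `d`, where
`t(c, d) = -1` if `c < 0` and `d < 0`, and `1` otherwise. -/
def jacobiStar (c d : ℤ) : ℤ :=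
  (if c < 0 ∧ d < 0 then -1 else 1) * jacobiSym c d.natAbs

/-- The entrywise embedding `SL₂(ℤ) → SL₂(ℝ)`. -/
noncomputable def SLintToReal : SL(2, ℤ) →* SL(2, ℝ) :=
  Matrix.SpecialLinearGroup.map (Int.castRingHom ℝ)

/-- The multiplier `v₀(γ) = (c/d)_*` for `γ = (a b; c d) ∈ SL₂(ℤ)`. -/
def v₀ (g : SL(2, ℤ)) : ℤ :=
  jacobiStar ((g : Matrix (Fin 2) (Fin 2) ℤ) 1 0) ((g : Matrix (Fin 2) (Fin 2) ℤ) 1 1)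

open NumberTheorySymbols

/-! ### The Jacobi symbol with fixed even numerator -/

/-- `(a/m) = (a/n)`, in product form, for odd `m` and `n` with `m ≡ -n` modulo `4a`. -/
theorem jacobiSym_mul_eq_one_of_dvd_add {a m n : ℕ} (hm : Odd m) (hn : Odd n)
    (ham : Nat.Coprime a n) (h : 4 * a ∣ m + n) : J(a | m) * J(a | n) = 1 := by
  rcases Nat.eq_zero_or_pos a with rfl | ha
  · have := hm.pos
    simp at h
    omega
  have : NeZero m := ⟨hm.pos.ne'⟩
  have : NeZero n := ⟨hn.pos.ne'⟩
  have : NeZero (4 * a - 1) := ⟨by omega⟩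
  have hodd : Odd (4 * a - 1) := ⟨2 * a - 1, by omega⟩
  have hone : J(a | 4 * a - 1) = 1 := by
    have h4 : J((4 * a : ℤ) | 4 * a - 1) = 1 := by
      rw [← jacobiSym.one_left (4 * a - 1)]
      apply jacobiSym.mod_left'
      rw [Nat.cast_sub (by omega)]
      push_cast
      exact (Int.modEq_iff_dvd.2 ⟨1, by ring⟩ : 1 ≡ 4 * (a : ℤ) [ZMOD 4 * a - 1]).symm
    rwa [jacobiSym.mul_left, jacobiSym.at_four hodd, one_mul] at h4
  have hmod : m * n ≡ (4 * a - 1) * (n * n) [MOD 4 * a] := by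
    rw [← Int.natCast_modEq_iff, Int.modEq_iff_dvd]
    obtain ⟨k, hk⟩ := h
    refine ⟨n * n - k * n, ?_⟩
    rw [Nat.cast_mul _ (n * n), Nat.cast_sub (by omega)]
    have hk' : (m : ℤ) = 4 * a * k - n := by
      have : (m : ℤ) + n = 4 * a * k := by exact_mod_cast hk
      linarith
    push_cast
    rw [hk']
    ring
  rw [← jacobiSym.mul_right, jacobiSym.mod_right' a (hm.mul hn), hmod,
    ← jacobiSym.mod_right' a (hodd.mul (hn.mul hn)), jacobiSym.mul_right' _ (by omega)
      (mul_ne_zero hn.pos.ne' hn.pos.ne'), jacobiSym.mul_right, hone, one_mul, ← sq]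
  exact jacobiSym.sq_one (by simpa using ham)

/-- For `4 ∣ c`, the Jacobi symbol `(c/n)` depends on the odd natural number `n` only modulo `c`. -/
theorem jacobiSym_eq_of_dvd_sub {c : ℤ} {m n : ℕ} (hc : 4 ∣ c) (hm : Odd m) (hn : Odd n)
    (h : c ∣ m - n) : J(c | m) = J(c | n) := by
  obtain ⟨a, rfl⟩ := hc
  rw [jacobiSym.mul_left, jacobiSym.mul_left, jacobiSym.at_four hm, jacobiSym.at_four hn,
    one_mul, one_mul, jacobiSym.mod_right a hm, jacobiSym.mod_right a hn]
  congr 1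
  refine (Int.natCast_modEq_iff.1 (Int.modEq_iff_dvd.2 ?_) : m ≡ n [MOD 4 * a.natAbs])
  rw [dvd_sub_comm]
  push_cast
  refine dvd_trans ?_ h
  rw [← abs_dvd_abs]
  simp [abs_mul]

/-- The sign relating the two halves of the residues modulo `c` for `(c/·)`, when `4 ∣ c`. -/
theorem jacobiSym_eq_of_dvd_add {c : ℤ} {m n : ℕ} (hc : 4 ∣ c) (hm : Odd m) (hn : n % 4 = 3)
    (hcn : IsCoprime c n) (h : c ∣ m + n) :
    J(c | m) = (if c < 0 then -1 else 1) * J(c | n) := by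
  obtain ⟨a, rfl⟩ := hc
  have hn' : Odd n := Nat.odd_iff.2 (by omega)
  have hm4 : m % 4 = 1 := by
    have : (4 : ℤ) ∣ m + n := (dvd_mul_right 4 a).trans h
    omega
  have hcop : Nat.Coprime a.natAbs n := by
    have := Int.isCoprime_iff_gcd_eq_one.1 (hcn.of_mul_left_right)
    simpa [Int.gcd] using this
  have hdvd : 4 * a.natAbs ∣ m + n := by
    rw [← Int.natCast_dvd_natCast]
    push_cast
    refine dvd_trans ?_ h
    rw [← abs_dvd_abs]
    simp [abs_mul]
  have key := jacobiSym_mul_eq_one_of_dvd_add hm hn' hcop hdvd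
  have key' : J(a.natAbs | m) = J(a.natAbs | n) := Int.eq_of_mul_eq_one key
  rw [jacobiSym.mul_left, jacobiSym.mul_left, jacobiSym.at_four hm, jacobiSym.at_four hn',
    one_mul, one_mul]
  rcases lt_or_ge a 0 with ha | ha
  · have habs : a = -(a.natAbs : ℤ) := by omega
    rw [if_pos (by omega), habs, jacobiSym.neg _ hm, jacobiSym.neg _ hn', key',
      ZMod.χ₄_nat_one_mod_four hm4, ZMod.χ₄_nat_three_mod_four hn]
    ring
  · have habs : a = (a.natAbs : ℤ) := by omega
    rw [if_neg (by omega), one_mul, habs, key']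

/-- `(c/d)_*` is periodic in `d` modulo `c`, for `4 ∣ c` and `d ≡ 1` modulo `4`. -/
theorem jacobiStar_add_right {c d : ℤ} (hc : c % 4 = 0) (hd : d % 4 = 1) (hcd : IsCoprime c d) :
    jacobiStar c (c + d) = jacobiStar c d := by
  have hc' : 4 ∣ c := Int.dvd_of_emod_eq_zero hc
  have mixed : ∀ m n : ℤ, 0 < m → n < 0 → m % 4 = 1 → n % 4 = 1 → IsCoprime c n → c ∣ m - n →
      jacobiStar c m = jacobiStar c n := by
    intro m n hm hn hm4 hn4 hcop h
    unfold jacobiStar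
    rw [if_neg (by omega), one_mul, jacobiSym_eq_of_dvd_add hc' (n := n.natAbs)
      (Nat.odd_iff.2 (by omega)) (by omega)]
    · simp [hn]
    · rw [Int.ofNat_natAbs_of_nonpos hn.le]
      exact hcop.neg_right
    · rwa [Int.ofNat_natAbs_of_nonpos hn.le, Int.natAbs_of_nonneg hm.le, ← sub_eq_add_neg]
  have hcd' : IsCoprime c (c + d) := by simpa [add_comm] using hcd.add_mul_left_right 1
  rcases lt_or_ge d 0 with h₁ | h₁ <;> rcases lt_or_ge (c + d) 0 with h₂ | h₂
  · unfold jacobiStar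
    simp only [h₁, h₂, and_true]
    rw [jacobiSym_eq_of_dvd_sub hc' (n := d.natAbs) (Nat.odd_iff.2 (by omega))
      (Nat.odd_iff.2 (by omega))]
    exact ⟨-1, by omega⟩
  · exact mixed _ _ (by omega) h₁ (by omega) hd hcd ⟨1, by ring⟩
  · exact (mixed _ _ (by omega) h₂ hd (by omega) hcd' ⟨-1, by ring⟩).symm
  · unfold jacobiStar
    rw [if_neg (by omega), if_neg (by omega)]
    rw [jacobiSym_eq_of_dvd_sub hc' (n := d.natAbs) (Nat.odd_iff.2 (by omega))
      (Nat.odd_iff.2 (by omega))]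
    exact ⟨1, by omega⟩

theorem jacobiStar_add_mul_left (c d k : ℤ) :
    jacobiStar (c + k * d) d =
      (if d < 0 ∧ ¬(c < 0 ↔ c + k * d < 0) then -1 else 1) * jacobiStar c d := by
  have h : J(c + k * d | d.natAbs) = J(c | d.natAbs) := by
    apply jacobiSym.mod_left'
    refine Int.ModEq.symm (Int.modEq_iff_dvd.2 ?_)
    rw [Int.natAbs_dvd]
    exact ⟨k, by ring⟩
  unfold jacobiStar
  rw [h]
  by_cases h₁ : d < 0 <;> by_cases h₂ : c < 0 <;> by_cases h₃ : c + k * d < 0 <;>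
    simp [h₁, h₂, h₃]

/-! ### The real cocycle -/

theorem hilbertR_mul_self (a b : ℝ) : hilbertR a b * hilbertR a b = 1 := by
  unfold hilbertR
  split_ifs <;> norm_num

theorem cpow_half_eq_exp {u v : ℂ} (h : exp v = u) (h₁ : -Real.pi < v.im) (h₂ : v.im ≤ Real.pi)
    (hu : u ≠ 0) : u ^ (1 / 2 : ℂ) = exp (v / 2) := by
  rw [cpow_def_of_ne_zero hu, ← h, log_exp h₁ h₂, mul_one_div]

theorem exp_half_add_two_pi (v : ℂ) : exp ((v + 2 * Real.pi * I) / 2) = -exp (v / 2) := by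
  rw [show (v + 2 * Real.pi * I) / 2 = v / 2 + Real.pi * I by ring, exp_add, exp_pi_mul_I]
  ring

theorem exp_half_sub_two_pi (v : ℂ) : exp ((v - 2 * Real.pi * I) / 2) = -exp (v / 2) := by
  rw [← neg_eq_iff_eq_neg, ← exp_half_add_two_pi, sub_add_cancel]

/-- The defect of multiplicativity of the principal square root is a Hilbert symbol. -/
theorem cpow_half_mul {u w : ℂ} (hu : u ∈ slitPlane) (hw : w ≠ 0) {x y r : ℝ} (hx : x ≠ 0) (hy : y ≠ 0)
    (hr : r ≠ 0) (hxu : x < 0 ↔ u.im < 0) (hyw : y < 0 ↔ w.im < 0) (hruw : r < 0 ↔ (u * w).im < 0) :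
    u ^ (1 / 2 : ℂ) * w ^ (1 / 2 : ℂ) =
      (hilbertR (x * r) (y * r) : ℂ) * (u * w) ^ (1 / 2 : ℂ) := by
  have hu₂ := (arg_le_pi u).lt_of_ne (slitPlane_arg_ne_pi hu)
  replace hu := slitPlane_ne_zero hu
  have huw : u * w ≠ 0 := mul_ne_zero hu hw
  have hprod : u ^ (1 / 2 : ℂ) * w ^ (1 / 2 : ℂ) = exp ((log u + log w) / 2) := by
    rw [cpow_def_of_ne_zero hu, cpow_def_of_ne_zero hw, ← exp_add]
    congr 1
    ring
  have hexp : exp (log u + log w) = u * w := by rw [exp_add, exp_log hu, exp_log hw]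
  have him : (log u + log w).im = arg u + arg w := by simp [log_im]
  rw [← arg_neg_iff] at hxu hyw hruw
  have hu₁ := neg_pi_lt_arg u
  have hw₁ := neg_pi_lt_arg w
  have hw₂ := arg_le_pi w
  have harg : ∀ v : ℂ, exp v = u * w → -Real.pi < v.im → v.im ≤ Real.pi → (r < 0 ↔ v.im < 0) := by
    intro v hv h₁ h₂
    rw [hruw, ← hv, ← log_im, log_exp h₁ h₂]
  rw [hprod]
  rcases lt_or_ge Real.pi (arg u + arg w) with hbig | hbig
  · have hv : exp (log u + log w - 2 * Real.pi * I) = u * w := by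
      rw [exp_sub, hexp, exp_two_pi_mul_I, div_one]
    have hvim : (log u + log w - 2 * Real.pi * I).im = arg u + arg w - 2 * Real.pi := by
      rw [sub_im, him]; simp
    have hr0 : r < 0 := by
      rw [harg _ hv (by rw [hvim]; linarith) (by rw [hvim]; linarith), hvim]
      linarith
    have hx0 : 0 < x := lt_of_le_of_ne (not_lt.1 fun h => by linarith [hxu.1 h]) hx.symm
    have hy0 : 0 < y := lt_of_le_of_ne (not_lt.1 fun h => by linarith [hyw.1 h]) hy.symm
    rw [cpow_half_eq_exp hv (by rw [hvim]; linarith) (by rw [hvim]; linarith) huw,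
      exp_half_sub_two_pi, hilbertR, if_pos ⟨mul_neg_of_pos_of_neg hx0 hr0,
        mul_neg_of_pos_of_neg hy0 hr0⟩]
    simp
  rcases le_or_gt (arg u + arg w) (-Real.pi) with hsmall | hsmall
  · have hv : exp (log u + log w + 2 * Real.pi * I) = u * w := by
      rw [exp_add, hexp, exp_two_pi_mul_I, mul_one]
    have hvim : (log u + log w + 2 * Real.pi * I).im = arg u + arg w + 2 * Real.pi := by
      rw [add_im, him]; simp
    have hr0 : 0 < r := by
      refine lt_of_le_of_ne (not_lt.1 fun h => ?_) hr.symm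
      rw [harg _ hv (by rw [hvim]; linarith) (by rw [hvim]; linarith), hvim] at h
      linarith
    have hx0 : x < 0 := hxu.2 (by linarith)
    have hy0 : y < 0 := hyw.2 (by linarith)
    rw [cpow_half_eq_exp hv (by rw [hvim]; linarith) (by rw [hvim]; linarith) huw,
      exp_half_add_two_pi, hilbertR, if_pos ⟨mul_neg_of_neg_of_pos hx0 hr0,
        mul_neg_of_neg_of_pos hy0 hr0⟩]
    simp
  · have hrs := harg _ hexp (by rw [him]; exact hsmall) (by rw [him]; exact hbig)
    rw [him] at hrs
    rw [cpow_half_eq_exp hexp (by rw [him]; exact hsmall) (by rw [him]; exact hbig) huw,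
      hilbertR, if_neg]
    · simp
    rintro ⟨h₁, h₂⟩
    rcases lt_or_gt_of_ne hr with hr0 | hr0
    · have hx0 : 0 < x := pos_of_mul_neg_left h₁ hr0.le
      have hy0 : 0 < y := pos_of_mul_neg_left h₂ hr0.le
      have := mt hxu.2 hx0.not_gt
      have := mt hyw.2 hy0.not_gt
      linarith [hrs.1 hr0]
    · have hx0 : x < 0 := neg_of_mul_neg_left h₁ hr0.le
      have hy0 : y < 0 := neg_of_mul_neg_left h₂ hr0.le
      have := hxu.1 hx0
      have := hyw.1 hy0
      linarith [hrs.2 (by linarith)]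

/-! ### Elements of `Γ₁(4)` -/

open CongruenceSubgroup

theorem mem_Gamma1_four_iff {g : SL(2, ℤ)} : g ∈ Gamma1 4 ↔ g 1 0 % 4 = 0 ∧ g 1 1 % 4 = 1 := by
  have hdet : g 0 0 * g 1 1 - g 0 1 * g 1 0 = 1 := by
    rw [← Matrix.det_fin_two, g.det_coe]
  have h0 : ∀ n : ℤ, (n : ZMod 4) = 0 ↔ n % 4 = 0 := fun n => by
    rw [ZMod.intCast_zmod_eq_zero_iff_dvd]
    push_cast
    exact Int.dvd_iff_emod_eq_zero
  have h1 : ∀ n : ℤ, (n : ZMod 4) = 1 ↔ n % 4 = 1 := fun n => by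
    have := ZMod.intCast_eq_intCast_iff' n 1 4
    simpa using this
  rw [Gamma1_mem, h0, h1, h1]
  refine ⟨fun h => ⟨h.2.2, h.2.1⟩, fun h => ⟨?_, h.2, h.1⟩⟩
  rw [← h1]
  have hd : ((g 1 1 : ℤ) : ZMod 4) = 1 := (h1 _).2 h.2
  have hc : ((g 1 0 : ℤ) : ZMod 4) = 0 := (h0 _).2 h.1
  have := congrArg (Int.cast : ℤ → ZMod 4) hdet
  push_cast at this
  rw [hd, hc] at this
  simpa using this

theorem isCoprime_bottom_row (g : SL(2, ℤ)) : IsCoprime (g 1 0) (g 1 1) := by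
  have hdet : g 0 0 * g 1 1 - g 0 1 * g 1 0 = 1 := by
    rw [← Matrix.det_fin_two, g.det_coe]
  exact ⟨-g 0 1, g 0 0, by linarith⟩

theorem apply_one_one_of_apply_one_zero_eq_zero {g : SL(2, ℤ)} (hg : g ∈ Gamma1 4)
    (hc : g 1 0 = 0) : g 1 1 = 1 := by
  have h := isCoprime_bottom_row g
  rw [hc, isCoprime_zero_left, Int.isUnit_iff] at h
  have := (mem_Gamma1_four_iff.1 hg).2
  omega

theorem xEntry_SLintToReal {g : SL(2, ℤ)} (hg : g ∈ Gamma1 4) :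
    xEntry (SLintToReal g) = if g 1 0 = 0 then 1 else (g 1 0 : ℝ) := by
  by_cases hc : g 1 0 = 0
  · simp [xEntry, SLintToReal, hc, apply_one_one_of_apply_one_zero_eq_zero hg hc]
  · simp [xEntry, SLintToReal, hc]

theorem xEntry_ne_zero {g : SL(2, ℤ)} (hg : g ∈ Gamma1 4) : xEntry (SLintToReal g) ≠ 0 := by
  rw [xEntry_SLintToReal hg]
  split_ifs with h
  · exact one_ne_zero
  · exact_mod_cast h

theorem xEntry_neg_iff {g : SL(2, ℤ)} (hg : g ∈ Gamma1 4) :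
    xEntry (SLintToReal g) < 0 ↔ g 1 0 < 0 := by
  rw [xEntry_SLintToReal hg]
  split_ifs with h
  · simp [h]
  · exact_mod_cast Iff.rfl

theorem denom_SLintToReal (g : SL(2, ℤ)) (z : ℍ) :
    UpperHalfPlane.denom (SLintToReal g) z = (g 1 0 : ℂ) * z + (g 1 1 : ℂ) := by
  simp [UpperHalfPlane.denom, SLintToReal]

theorem Jfactor_SLintToReal {g : SL(2, ℤ)} (hg : g ∈ Gamma1 4) (z : ℍ) :
    Jfactor (SLintToReal g) z = UpperHalfPlane.denom (SLintToReal g) z ^ (1 / 2 : ℂ) := by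
  rw [denom_SLintToReal]
  by_cases hc : g 1 0 = 0
  · simp [Jfactor, SLintToReal, hc, apply_one_one_of_apply_one_zero_eq_zero hg hc]
  · simp [Jfactor, SLintToReal, hc]

theorem Jfactor_ne_zero {g : SL(2, ℤ)} (hg : g ∈ Gamma1 4) (z : ℍ) :
    Jfactor (SLintToReal g) z ≠ 0 := by
  rw [Jfactor_SLintToReal hg, cpow_def_of_ne_zero (UpperHalfPlane.denom_ne_zero _ z)]
  exact exp_ne_zero _

theorem im_denom (g : SL(2, ℤ)) (z : ℍ) :
    (UpperHalfPlane.denom (SLintToReal g) z).im = (g 1 0 : ℝ) * z.im := by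
  rw [denom_SLintToReal]
  simp

theorem denom_mem_slitPlane {g : SL(2, ℤ)} (hg : g ∈ Gamma1 4) (z : ℍ) :
    UpperHalfPlane.denom (SLintToReal g) z ∈ slitPlane := by
  by_cases hc : g 1 0 = 0
  · simp [denom_SLintToReal, hc, apply_one_one_of_apply_one_zero_eq_zero hg hc]
  · refine Or.inr ?_
    rw [im_denom]
    exact mul_ne_zero (Int.cast_ne_zero.2 hc) z.im_ne_zero

theorem im_denom_neg_iff (g : SL(2, ℤ)) (z : ℍ) :
    (UpperHalfPlane.denom (SLintToReal g) z).im < 0 ↔ g 1 0 < 0 := by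
  rw [im_denom, ← not_le, mul_nonneg_iff_of_pos_right z.im_pos, not_le]
  exact_mod_cast Iff.rfl

/-- The Kubota cocycle measures the failure of `J` to be an automorphy factor. -/
theorem Jfactor_mul {g h : SL(2, ℤ)} (hg : g ∈ Gamma1 4) (hh : h ∈ Gamma1 4) (z : ℍ) :
    Jfactor (SLintToReal g) (SLintToReal h • z) * Jfactor (SLintToReal h) z =
      (kubotaR (SLintToReal g) (SLintToReal h) : ℂ) * Jfactor (SLintToReal (g * h)) z := by
  have hgh := mul_mem hg hh
  have hden : UpperHalfPlane.denom (SLintToReal g) (SLintToReal h • z : ℍ) *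
      UpperHalfPlane.denom (SLintToReal h) z = UpperHalfPlane.denom (SLintToReal (g * h)) z := by
    rw [map_mul, map_mul, UpperHalfPlane.denom_cocycle_σ _ _ z,
      UpperHalfPlane.σ, if_pos (by simp)]
    rfl
  rw [Jfactor_SLintToReal hg, Jfactor_SLintToReal hh, Jfactor_SLintToReal hgh, ← hden, kubotaR,
    ← map_mul]
  refine cpow_half_mul (denom_mem_slitPlane hg _) (UpperHalfPlane.denom_ne_zero _ _)
    (xEntry_ne_zero hg) (xEntry_ne_zero hh) (xEntry_ne_zero hgh) ?_ ?_ ?_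
  · rw [xEntry_neg_iff hg, im_denom_neg_iff]
  · rw [xEntry_neg_iff hh, im_denom_neg_iff]
  · rw [xEntry_neg_iff hgh, hden, im_denom_neg_iff]

/-! ### Generators of `Γ₁(4)` -/

/-- The matrix `(1 0; 4 1)`. -/
def lowerFour : SL(2, ℤ) := ⟨!![1, 0; 4, 1], by simp⟩

theorem coe_lowerFour : (lowerFour : Matrix (Fin 2) (Fin 2) ℤ) = !![1, 0; 4, 1] := rfl

theorem coe_lowerFour_inv : ((lowerFour⁻¹ : SL(2, ℤ)) : Matrix (Fin 2) (Fin 2) ℤ) =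
    !![1, 0; -4, 1] := by
  simp [coe_lowerFour, Matrix.SpecialLinearGroup.coe_inv, Matrix.adjugate_fin_two]

theorem T_mem_Gamma1_four : ModularGroup.T ∈ Gamma1 4 :=
  mem_Gamma1_four_iff.2 (by simp [ModularGroup.T])

theorem lowerFour_mem_Gamma1_four : lowerFour ∈ Gamma1 4 :=
  mem_Gamma1_four_iff.2 (by simp [lowerFour])

/-- `Γ₁(4)` is generated by `T` and `(1 0; 4 1)`, by descent on the bottom row. -/
theorem Gamma1_four_le {H : Subgroup SL(2, ℤ)} (hT : ModularGroup.T ∈ H) (hU : lowerFour ∈ H) :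
    Gamma1 4 ≤ H := by
  intro g hg
  induction hn : (g 1 0).natAbs + (g 1 1).natAbs using Nat.strong_induction_on generalizing g with
  | _ n ih =>
  have hmem := mem_Gamma1_four_iff.1 hg
  by_cases hc : g 1 0 = 0
  · have hd := apply_one_one_of_apply_one_zero_eq_zero hg hc
    have hdet : g 0 0 * g 1 1 - g 0 1 * g 1 0 = 1 := by
      rw [← Matrix.det_fin_two, g.det_coe]
    have : g = ModularGroup.T ^ (g 0 1) := by
      have ha : g 0 0 = 1 := by simpa [hc, hd] using hdet
      apply Subtype.ext
      rw [ModularGroup.coe_T_zpow, Matrix.eta_fin_two (g : Matrix (Fin 2) (Fin 2) ℤ), ha, hc, hd]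
      simp
    rw [this]
    exact zpow_mem hT _
  have descend : ∀ k ∈ H, k ∈ Gamma1 4 →
      ((g * k) 1 0).natAbs + ((g * k) 1 1).natAbs < n → g ∈ H := fun k hk hk' hlt =>
    (Subgroup.mul_mem_cancel_right _ hk).1 (ih _ hlt (mul_mem hg hk') rfl)
  have hT4 := T_mem_Gamma1_four
  have hU4 := lowerFour_mem_Gamma1_four
  have hTc : (g * ModularGroup.T) 1 0 = g 1 0 := by
    simp [ModularGroup.coe_T, Matrix.mul_apply, Fin.sum_univ_two]
  have hTd : (g * ModularGroup.T) 1 1 = g 1 0 + g 1 1 := by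
    simp [ModularGroup.coe_T, Matrix.mul_apply, Fin.sum_univ_two]
  have hTc' : (g * ModularGroup.T⁻¹) 1 0 = g 1 0 := by
    rw [Matrix.SpecialLinearGroup.coe_mul, ModularGroup.coe_T_inv, Matrix.mul_apply, Fin.sum_univ_two]
    simp
  have hTd' : (g * ModularGroup.T⁻¹) 1 1 = g 1 1 - g 1 0 := by
    rw [Matrix.SpecialLinearGroup.coe_mul, ModularGroup.coe_T_inv, Matrix.mul_apply, Fin.sum_univ_two]
    simp; ring
  have hUc : (g * lowerFour) 1 0 = g 1 0 + 4 * g 1 1 := by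
    simp [coe_lowerFour, Matrix.mul_apply, Fin.sum_univ_two, mul_comm]
  have hUd : (g * lowerFour) 1 1 = g 1 1 := by
    simp [coe_lowerFour, Matrix.mul_apply, Fin.sum_univ_two]
  have hUc' : (g * lowerFour⁻¹) 1 0 = g 1 0 - 4 * g 1 1 := by
    rw [Matrix.SpecialLinearGroup.coe_mul, coe_lowerFour_inv, Matrix.mul_apply, Fin.sum_univ_two]
    simp; ring
  have hUd' : (g * lowerFour⁻¹) 1 1 = g 1 1 := by
    rw [Matrix.SpecialLinearGroup.coe_mul, coe_lowerFour_inv, Matrix.mul_apply, Fin.sum_univ_two]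
    simp
  by_cases hlt : (g 1 0).natAbs < 2 * (g 1 1).natAbs
  · by_cases hs : 0 < g 1 0 ↔ 0 < g 1 1
    · refine descend _ (inv_mem hT) (inv_mem hT4) ?_
      rw [hTc', hTd']
      omega
    · refine descend _ hT hT4 ?_
      rw [hTc, hTd]
      omega
  · by_cases hs : 0 < g 1 0 ↔ 0 < g 1 1
    · refine descend _ (inv_mem hU) (inv_mem hU4) ?_
      rw [hUc', hUd']
      omega
    · refine descend _ hU hU4 ?_
      rw [hUc, hUd]
      omega

/-! ### The theta multiplier -/

/-- The automorphy factor `v₀(γ) J(γ, z)`. -/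
noncomputable def thetaFactor (g : SL(2, ℤ)) (z : ℍ) : ℂ :=
  (v₀ g : ℂ) * Jfactor (SLintToReal g) z

theorem v₀_ne_zero (g : SL(2, ℤ)) : v₀ g ≠ 0 := by
  refine mul_ne_zero (by split_ifs <;> norm_num) (jacobiSym.ne_zero ?_)
  have := Int.isCoprime_iff_gcd_eq_one.1 (isCoprime_bottom_row g)
  simpa only [Int.gcd, Int.natAbs_natCast] using this

theorem thetaFactor_ne_zero {g : SL(2, ℤ)} (hg : g ∈ Gamma1 4) (z : ℍ) : thetaFactor g z ≠ 0 :=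
  mul_ne_zero (Int.cast_ne_zero.2 (v₀_ne_zero g)) (Jfactor_ne_zero hg z)

theorem thetaFactor_mul_iff {g h : SL(2, ℤ)} (hg : g ∈ Gamma1 4) (hh : h ∈ Gamma1 4) (z : ℍ) :
    thetaFactor (g * h) z = thetaFactor g (SLintToReal h • z) * thetaFactor h z ↔
      (v₀ g : ℂ) * (v₀ h : ℂ) =
        ((kubotaR (SLintToReal g) (SLintToReal h) : ℝ) : ℂ) * (v₀ (g * h) : ℂ) := by
  have hJ := Jfactor_mul hg hh z
  have hne := Jfactor_ne_zero (mul_mem hg hh) z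
  have hsq : (kubotaR (SLintToReal g) (SLintToReal h) : ℂ) *
      (kubotaR (SLintToReal g) (SLintToReal h) : ℂ) = 1 := by
    exact_mod_cast hilbertR_mul_self _ _
  have hprod : thetaFactor g (SLintToReal h • z) * thetaFactor h z =
      (kubotaR (SLintToReal g) (SLintToReal h) : ℂ) * ((v₀ g : ℂ) * v₀ h) *
        Jfactor (SLintToReal (g * h)) z := by
    unfold thetaFactor
    linear_combination (v₀ g : ℂ) * v₀ h * hJ
  rw [hprod, thetaFactor, mul_left_inj' hne]
  constructor <;> intro H
  · linear_combination -(kubotaR (SLintToReal g) (SLintToReal h) : ℂ) * H -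
      (v₀ g : ℂ) * v₀ h * hsq
  · linear_combination -(kubotaR (SLintToReal g) (SLintToReal h) : ℂ) * H -
      (v₀ (g * h) : ℂ) * hsq

theorem thetaFactor_one (z : ℍ) : thetaFactor 1 z = 1 := by
  rw [thetaFactor, Jfactor_SLintToReal (one_mem _), denom_SLintToReal]
  simp [v₀, jacobiStar]

/-- The elements `h` of `Γ₁(4)` for which the automorphy relation holds for all pairs `(g, h)`. -/
def thetaSubgroup : Subgroup SL(2, ℤ) where
  carrier := {h | h ∈ Gamma1 4 ∧ ∀ g ∈ Gamma1 4, ∀ z : ℍ,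
    thetaFactor (g * h) z = thetaFactor g (SLintToReal h • z) * thetaFactor h z}
  one_mem' := ⟨one_mem _, fun g _ z => by simp [thetaFactor_one]⟩
  mul_mem' := by
    rintro h k ⟨hh, Hh⟩ ⟨hk, Hk⟩
    refine ⟨mul_mem hh hk, fun g hg z => ?_⟩
    rw [← mul_assoc, Hk _ (mul_mem hg hh), Hh _ hg, Hk _ hh, map_mul, mul_smul, mul_assoc]
  inv_mem' := by
    rintro h ⟨hh, Hh⟩
    refine ⟨inv_mem hh, fun g hg z => ?_⟩
    have hz : SLintToReal h • SLintToReal h⁻¹ • z = z := by rw [map_inv, smul_inv_smul]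
    have h₁ := Hh (g * h⁻¹) (mul_mem hg (inv_mem hh)) (SLintToReal h⁻¹ • z)
    have h₂ := Hh h⁻¹ (inv_mem hh) (SLintToReal h⁻¹ • z)
    rw [hz, inv_mul_cancel_right] at h₁
    rw [hz, inv_mul_cancel, thetaFactor_one] at h₂
    rw [h₁, mul_assoc, mul_comm (thetaFactor h _), ← h₂, mul_one]

theorem T_mem_thetaSubgroup : ModularGroup.T ∈ thetaSubgroup := by
  have hT := T_mem_Gamma1_four
  refine ⟨hT, fun g hg z => ?_⟩
  have hgT := mul_mem hg hT
  have hc : (g * ModularGroup.T) 1 0 = g 1 0 := by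
    simp [ModularGroup.coe_T, Matrix.mul_apply, Fin.sum_univ_two]
  have hd : (g * ModularGroup.T) 1 1 = g 1 0 + g 1 1 := by
    simp [ModularGroup.coe_T, Matrix.mul_apply, Fin.sum_univ_two]
  have hv : v₀ (g * ModularGroup.T) = v₀ g := by
    rw [v₀, hc, hd]
    have := mem_Gamma1_four_iff.1 hg
    exact jacobiStar_add_right this.1 this.2 (isCoprime_bottom_row g)
  have hvT : v₀ ModularGroup.T = 1 := by simp [v₀, ModularGroup.T, jacobiStar]
  have hk : kubotaR (SLintToReal g) (SLintToReal ModularGroup.T) = 1 := by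
    rw [kubotaR, ← map_mul, xEntry_SLintToReal hgT, hc, ← xEntry_SLintToReal hg, hilbertR,
      if_neg fun h => (mul_self_nonneg _).not_gt h.1]
  rw [thetaFactor_mul_iff hg hT, hv, hvT, hk]
  simp

theorem lowerFour_mem_thetaSubgroup : lowerFour ∈ thetaSubgroup := by
  have hU := lowerFour_mem_Gamma1_four
  refine ⟨hU, fun g hg z => ?_⟩
  have hgU := mul_mem hg hU
  have hc : (g * lowerFour) 1 0 = g 1 0 + 4 * g 1 1 := by
    simp [coe_lowerFour, Matrix.mul_apply, Fin.sum_univ_two, mul_comm]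
  have hd : (g * lowerFour) 1 1 = g 1 1 := by
    simp [coe_lowerFour, Matrix.mul_apply, Fin.sum_univ_two]
  have hvU : v₀ lowerFour = 1 := by simp [v₀, lowerFour, jacobiStar]
  have hxU : xEntry (SLintToReal lowerFour) = 4 := by
    rw [xEntry_SLintToReal hU]; simp [lowerFour]
  have hk : kubotaR (SLintToReal g) (SLintToReal lowerFour) =
      ((if g 1 1 < 0 ∧ ¬(g 1 0 < 0 ↔ g 1 0 + 4 * g 1 1 < 0) then -1 else 1 : ℤ) : ℝ) := by
    have h₁ := xEntry_neg_iff hg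
    have h₂ := xEntry_neg_iff hgU
    have h₃ := xEntry_ne_zero hg
    rw [hc] at h₂
    rw [kubotaR, ← map_mul, hxU, hilbertR]
    have hiff : (xEntry (SLintToReal g) * xEntry (SLintToReal (g * lowerFour)) < 0 ∧
        4 * xEntry (SLintToReal (g * lowerFour)) < 0) ↔
        (g 1 1 < 0 ∧ ¬(g 1 0 < 0 ↔ g 1 0 + 4 * g 1 1 < 0)) := by
      have h₄ : 4 * xEntry (SLintToReal (g * lowerFour)) < 0 ↔ g 1 0 + 4 * g 1 1 < 0 := by
        rw [← h₂]
        constructor <;> intro <;> linarith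
      rw [h₄]
      by_cases h₅ : g 1 0 + 4 * g 1 1 < 0
      · have h₆ : xEntry (SLintToReal g) * xEntry (SLintToReal (g * lowerFour)) < 0 ↔
            ¬ g 1 0 < 0 := by
          rw [← h₁, not_lt, h₃.symm.le_iff_lt]
          exact ⟨fun h => pos_of_mul_neg_left h (h₂.2 h₅).le,
            fun h => mul_neg_of_pos_of_neg h (h₂.2 h₅)⟩
        rw [h₆]
        omega
      · omega
    simp only [hiff]
    split_ifs <;> simp
  rw [thetaFactor_mul_iff hg hU, hvU, hk]
  rw [v₀, v₀, hc, hd, jacobiStar_add_mul_left]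
  split_ifs <;> simp

/-- On `Γ₁(4) = {(a b; c d) ∈ SL₂(ℤ) : c ≡ 0, d ≡ 1 (mod 4)}`, the
function `v₀((a b; c d)) = (c/d)_*` satisfies
`v₀(γ₁)·v₀(γ₂) = c_ℝ(γ₁, γ₂)·v₀(γ₁γ₂)`; equivalently,
`(γ, z) ↦ v₀(γ)·J(γ, z)` is an automorphy factor on `Γ₁(4) × ℍ`, so `v₀` is a
multiplier system of weight `1/2` for `Γ₁(4)`. -/
theorem stmt5 (γ₁ γ₂ : SL(2, ℤ))
    (h₁ : (γ₁ : Matrix (Fin 2) (Fin 2) ℤ) 1 0 % 4 = 0 ∧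
          (γ₁ : Matrix (Fin 2) (Fin 2) ℤ) 1 1 % 4 = 1)
    (h₂ : (γ₂ : Matrix (Fin 2) (Fin 2) ℤ) 1 0 % 4 = 0 ∧
          (γ₂ : Matrix (Fin 2) (Fin 2) ℤ) 1 1 % 4 = 1) :
    ((v₀ γ₁ : ℂ) * (v₀ γ₂ : ℂ)
      = ((kubotaR (SLintToReal γ₁) (SLintToReal γ₂) : ℝ) : ℂ) * (v₀ (γ₁ * γ₂) : ℂ)) ∧
    (∀ z : ℍ,
      (v₀ (γ₁ * γ₂) : ℂ) * Jfactor (SLintToReal (γ₁ * γ₂)) z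
        = ((v₀ γ₁ : ℂ) * Jfactor (SLintToReal γ₁) (SLintToReal γ₂ • z))
          * ((v₀ γ₂ : ℂ) * Jfactor (SLintToReal γ₂) z)) := by
  have hγ₁ := mem_Gamma1_four_iff.2 h₁
  have hγ₂ := mem_Gamma1_four_iff.2 h₂
  have key := (Gamma1_four_le T_mem_thetaSubgroup lowerFour_mem_thetaSubgroup hγ₂).2 γ₁ hγ₁
  exact ⟨(thetaFactor_mul_iff hγ₁ hγ₂ UpperHalfPlane.I).1 (key _), key⟩
end

section
/- Let D > 1 be a square-free integer with D ≡ 1 (mod 8), F = ℚ(√D), 𝒪 the ring of integers of F, and 𝔡 the different ideal of F/ℚ. Then there exist a totally positive β ∈ F^× and a fractional ideal 𝔞 of F with (8β)·𝔡 = 𝔞² if and only if every prime p dividing D satisfies p ≡ 1 (mod 4). -/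
open scoped NumberField nonZeroDivisors

theorem Squarefree.exists_int_eq_of_mul_sq_eq {D : ℤ} (hD : Squarefree D) {q : ℚ} {m : ℤ}
    (h : (D : ℚ) * q ^ 2 = m) : ∃ n : ℤ, q = n := by
  have hden : (q.den : ℚ) ≠ 0 := by exact_mod_cast q.den_ne_zero
  have h1 : D * q.num ^ 2 = m * (q.den : ℤ) ^ 2 := by
    have : (D : ℚ) * q.num ^ 2 = m * (q.den : ℚ) ^ 2 := by
      rw [← h]
      nth_rewrite 2 [← Rat.num_div_den q]
      field_simp
    exact_mod_cast this
  have hcop : IsCoprime ((q.den : ℤ) ^ 2) (q.num ^ 2) :=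
    (Rat.isCoprime_num_den q).symm.pow
  have hdvd : (q.den : ℤ) ^ 2 ∣ D :=
    hcop.dvd_of_dvd_mul_right (h1 ▸ Dvd.intro_left _ rfl)
  have hu := hD (q.den : ℤ) (by rwa [← sq])
  have hd1 : q.den = 1 := by
    have := Int.isUnit_iff_natAbs_eq.mp hu
    simpa using this
  exact ⟨q.num, (Rat.coe_int_num_of_den_eq_one hd1).symm⟩

theorem Squarefree.rat_sq_ne {D : ℤ} (hD1 : 1 < D) (hD : Squarefree D) (q : ℚ) :
    q ^ 2 ≠ D := by
  intro h
  obtain ⟨n, rfl⟩ := Squarefree.exists_int_eq_of_mul_sq_eq (D := 1) squarefree_one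
    (q := q) (m := D) (by simpa using h)
  have h' : n * n = D := by rw [← sq]; exact_mod_cast h
  have := hD n ⟨1, by rw [mul_one, h']⟩
  have := Int.isUnit_mul_self this
  omega

section
variable {D : ℤ} {F : Type*} [Field F] [NumberField F] {sd : F}

theorem exists_quadraticAlgebra_algEquiv (hD1 : 1 < D) (hsq : Squarefree D)
    (hsd : sd ^ 2 = (D : F)) (hadj : Algebra.adjoin ℚ {sd} = ⊤) :
    ∃ e : QuadraticAlgebra ℚ (D : ℚ) 0 ≃ₐ[ℚ] F, ∀ u v : ℚ, e ⟨u, v⟩ = u + v * sd := by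
  let f : QuadraticAlgebra ℚ (D : ℚ) 0 →ₐ[ℚ] F :=
    QuadraticAlgebra.lift ⟨sd, by rw [← sq, hsd]; simp [Algebra.smul_def]⟩
  have hf : ∀ u v : ℚ, f ⟨u, v⟩ = u + v * sd := by
    intro u v
    simp [f, QuadraticAlgebra.lift, Algebra.smul_def]
  have hinj : Function.Injective f := by
    rw [injective_iff_map_eq_zero]
    rintro ⟨u, v⟩ h
    rw [hf] at h
    by_cases hv : v = 0
    · subst hv
      have : u = 0 := by simpa using h
      subst this; rfl
    · exfalso
      apply Squarefree.rat_sq_ne hD1 hsq (u / v)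
      have hv' : (v : F) ≠ 0 := by exact_mod_cast hv
      have : ((u : F) / v) ^ 2 = D := by
        rw [← hsd, div_pow, div_eq_iff (pow_ne_zero 2 hv')]
        linear_combination (u - v * sd) * h
      exact_mod_cast this
  have hsurj : Function.Surjective f := by
    rw [← AlgHom.range_eq_top, eq_top_iff, ← hadj, Algebra.adjoin_le_iff,
      Set.singleton_subset_iff]
    exact ⟨⟨0, 1⟩, by simp [hf]⟩
  exact ⟨AlgEquiv.ofBijective f ⟨hinj, hsurj⟩, hf⟩

theorem QuadraticAlgebra.leftMulMatrix_basis {R : Type*} [CommRing R] (a b : R)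
    (x : QuadraticAlgebra R a b) :
    Algebra.leftMulMatrix (QuadraticAlgebra.basis a b) x =
      !![x.re, a * x.im; x.im, x.re + b * x.im] := by
  ext i j
  rw [Algebra.leftMulMatrix_eq_repr_mul]
  fin_cases i <;> fin_cases j <;> simp [QuadraticAlgebra.basis]

theorem QuadraticAlgebra.algebraNorm_eq_norm {R : Type*} [CommRing R] (a b : R)
    (x : QuadraticAlgebra R a b) : Algebra.norm R x = x.norm := by
  rw [Algebra.norm_eq_matrix_det (QuadraticAlgebra.basis a b),
    QuadraticAlgebra.leftMulMatrix_basis, Matrix.det_fin_two_of, QuadraticAlgebra.norm_def]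
  ring

theorem QuadraticAlgebra.algebraTrace_eq {R : Type*} [CommRing R] (a b : R)
    (x : QuadraticAlgebra R a b) : Algebra.trace R _ x = 2 * x.re + b * x.im := by
  rw [Algebra.trace_eq_matrix_trace (QuadraticAlgebra.basis a b),
    QuadraticAlgebra.leftMulMatrix_basis, Matrix.trace_fin_two_of]
  ring

theorem exists_rat_coords (hD1 : 1 < D) (hsq : Squarefree D)
    (hsd : sd ^ 2 = (D : F)) (hadj : Algebra.adjoin ℚ {sd} = ⊤) (x : F) :
    ∃ u v : ℚ, x = u + v * sd := by
  obtain ⟨e, he⟩ := exists_quadraticAlgebra_algEquiv hD1 hsq hsd hadj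
  exact ⟨(e.symm x).re, (e.symm x).im, by rw [← he]; exact (e.apply_symm_apply x).symm⟩

theorem norm_rat_coords (hD1 : 1 < D) (hsq : Squarefree D)
    (hsd : sd ^ 2 = (D : F)) (hadj : Algebra.adjoin ℚ {sd} = ⊤) (u v : ℚ) :
    Algebra.norm ℚ ((u : F) + v * sd) = u ^ 2 - D * v ^ 2 := by
  obtain ⟨e, he⟩ := exists_quadraticAlgebra_algEquiv hD1 hsq hsd hadj
  rw [← he, Algebra.norm_eq_of_algEquiv, QuadraticAlgebra.algebraNorm_eq_norm,
    QuadraticAlgebra.norm_def]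
  ring

theorem trace_rat_coords (hD1 : 1 < D) (hsq : Squarefree D)
    (hsd : sd ^ 2 = (D : F)) (hadj : Algebra.adjoin ℚ {sd} = ⊤) (u v : ℚ) :
    Algebra.trace ℚ F ((u : F) + v * sd) = 2 * u := by
  obtain ⟨e, he⟩ := exists_quadraticAlgebra_algEquiv hD1 hsq hsd hadj
  rw [← he, Algebra.trace_eq_of_algEquiv, QuadraticAlgebra.algebraTrace_eq]
  simp

theorem exists_ringHom_real (hD1 : 1 < D) (hsq : Squarefree D)
    (hsd : sd ^ 2 = (D : F)) (hadj : Algebra.adjoin ℚ {sd} = ⊤) {r : ℝ} (hr : r ^ 2 = D) :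
    ∃ φ : F →+* ℝ, φ sd = r := by
  obtain ⟨e, he⟩ := exists_quadraticAlgebra_algEquiv hD1 hsq hsd hadj
  let f : QuadraticAlgebra ℚ (D : ℚ) 0 →ₐ[ℚ] ℝ :=
    QuadraticAlgebra.lift ⟨r, by rw [← sq, hr]; simp [Algebra.smul_def]⟩
  refine ⟨(f.comp (e.symm : F →ₐ[ℚ] _)).toRingHom, ?_⟩
  have h : sd = e ⟨0, 1⟩ := by simp [he]
  have h2 : e.symm sd = ⟨0, 1⟩ := by rw [h, e.symm_apply_apply]
  simp [h2, f, QuadraticAlgebra.lift]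

theorem exists_int_coords_of_isIntegral (hD1 : 1 < D) (hsq : Squarefree D) (hD4 : D % 4 = 1)
    (hsd : sd ^ 2 = (D : F)) (hadj : Algebra.adjoin ℚ {sd} = ⊤) {x : F} (hx : IsIntegral ℤ x) :
    ∃ m n : ℤ, x = m + n * ((1 + sd) / 2) := by
  obtain ⟨u, v, rfl⟩ := exists_rat_coords hD1 hsq hsd hadj x
  obtain ⟨t, ht⟩ := IsIntegrallyClosed.isIntegral_iff.mp (Algebra.isIntegral_trace (L := ℚ) hx)
  obtain ⟨N, hN⟩ := IsIntegrallyClosed.isIntegral_iff.mp (Algebra.isIntegral_norm (K := ℚ) hx)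
  rw [trace_rat_coords hD1 hsq hsd hadj] at ht
  rw [norm_rat_coords hD1 hsq hsd hadj] at hN
  simp only [eq_intCast] at ht hN
  obtain ⟨s, hs⟩ := hsq.exists_int_eq_of_mul_sq_eq (q := 2 * v) (m := t ^ 2 - 4 * N) (by
    push_cast
    rw [ht, hN]
    ring)
  have hts : t ^ 2 - D * s ^ 2 = 4 * N := by
    have : (t : ℚ) ^ 2 - D * s ^ 2 = 4 * N := by
      rw [ht, hN, ← hs]; ring
    exact_mod_cast this
  have hpar : (2 : ℤ) ∣ t - s := by
    have h2 : (2 : ℤ) ∣ (t - s) ^ 2 := by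
      obtain ⟨k, hk⟩ : ∃ k, D = 4 * k + 1 := ⟨D / 4, by omega⟩
      exact ⟨2 * N + 2 * k * s ^ 2 - s * t + s ^ 2, by
        subst hk; linear_combination hts⟩
    exact Int.prime_two.dvd_of_dvd_pow h2
  obtain ⟨m, hm⟩ := hpar
  refine ⟨m, s, ?_⟩
  have hu : u = m + s / 2 := by
    have : (t : ℚ) = 2 * m + s := by exact_mod_cast (by omega : t = 2 * m + s)
    linarith
  have hv : v = s / 2 := by linarith
  rw [hu, hv]
  push_cast
  ring

theorem differentIdeal_eq_span_sqrt (hD1 : 1 < D) (hsq : Squarefree D) (hD4 : D % 4 = 1)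
    (hadj : Algebra.adjoin ℚ {sd} = ⊤) {s : 𝓞 F} (hs : algebraMap (𝓞 F) F s = sd)
    (hs2 : s ^ 2 = (D : 𝓞 F)) :
    differentIdeal ℤ (𝓞 F) = Ideal.span {s} := by
  have hsd : sd ^ 2 = (D : F) := by
    rw [← hs, ← map_pow, hs2, map_intCast]
  obtain ⟨c, hc⟩ : ∃ c, D = 4 * c + 1 := ⟨D / 4, by omega⟩
  let P : Polynomial ℤ := Polynomial.X ^ 2 - Polynomial.X - Polynomial.C c
  have hPm : P.Monic := by unfold P; monicity!
  have hPd : P.natDegree = 2 := by unfold P; compute_degree!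
  have hP0 : ∀ y : F, 2 * y - 1 = sd → y ^ 2 - y - c = 0 := by
    intro y hy
    have h := hsd
    rw [hc, ← hy] at h
    push_cast at h
    linear_combination h / 4
  have hwint : IsIntegral ℤ ((1 + sd) / 2) := by
    refine ⟨P, hPm, ?_⟩
    have h := hP0 ((1 + sd) / 2) (by ring)
    rw [show P = Polynomial.X ^ 2 - Polynomial.X - Polynomial.C c from rfl, Polynomial.eval₂_sub,
      Polynomial.eval₂_sub, Polynomial.eval₂_pow, Polynomial.eval₂_X, Polynomial.eval₂_C]
    simpa using h
  let w : 𝓞 F := ⟨(1 + sd) / 2, hwint⟩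
  have hw : algebraMap (𝓞 F) F w = (1 + sd) / 2 := rfl
  have hws : 2 * w - 1 = s := by
    apply FaithfulSMul.algebraMap_injective (𝓞 F) F
    rw [map_sub, map_mul, map_ofNat, map_one, hw, hs]
    ring
  have hwP : Polynomial.aeval w P = 0 := by
    apply FaithfulSMul.algebraMap_injective (𝓞 F) F
    simpa [P] using hP0 (algebraMap (𝓞 F) F w) (by rw [hw]; ring)
  have hwZ : IsIntegral ℤ w := ⟨P, hPm, hwP⟩
  have hwnr : w ∉ (algebraMap ℤ (𝓞 F)).range := by
    rintro ⟨n, hn⟩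
    have : ((2 * n - 1 : ℤ) : F) = sd := by
      rw [← hs, ← hws, ← hn]
      simp [map_ofNat (algebraMap (𝓞 F) F) 2]
    rw [← this] at hsd
    apply Squarefree.rat_sq_ne hD1 hsq ((2 * n - 1 : ℤ) : ℚ)
    exact_mod_cast hsd
  have hmin : minpoly ℤ w = P := by
    refine (Polynomial.eq_of_monic_of_dvd_of_natDegree_le (minpoly.monic hwZ) hPm
      (minpoly.isIntegrallyClosed_dvd hwZ hwP) ?_).symm
    rw [hPd]
    exact (minpoly.two_le_natDegree_iff hwZ).mpr hwnr
  have htop : Algebra.adjoin ℤ {w} = ⊤ := by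
    rw [eq_top_iff]
    rintro x -
    obtain ⟨m, n, hmn⟩ := exists_int_coords_of_isIntegral hD1 hsq hD4 hsd hadj
      (NumberField.RingOfIntegers.isIntegral_coe x)
    have : x = m + n * w := by
      apply FaithfulSMul.algebraMap_injective (𝓞 F) F
      rw [map_add, map_mul, map_intCast, map_intCast, hmn, hw]
    rw [this]
    exact add_mem (intCast_mem _ _)
      (mul_mem (intCast_mem _ _) (Algebra.self_mem_adjoin_singleton ℤ w))
  have hwtop : Algebra.adjoin ℚ {algebraMap (𝓞 F) F w} = ⊤ := by
    rw [eq_top_iff, ← hadj, Algebra.adjoin_le_iff, Set.singleton_subset_iff]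
    have hsdw : sd = 2 * algebraMap (𝓞 F) F w - 1 := by
      change sd = 2 * ((1 + sd) / 2) - 1
      ring
    have hmem := Algebra.self_mem_adjoin_singleton ℚ (algebraMap (𝓞 F) F w)
    rw [hsdw]
    exact sub_mem (mul_mem (ofNat_mem _ 2) hmem) (one_mem _)
  have key := conductor_mul_differentIdeal ℤ ℚ F w hwtop
  rw [conductor_eq_top_of_adjoin_eq_top htop, Ideal.top_mul, hmin] at key
  rw [key, ← hws]
  simp [P, map_ofNat]
end

theorem span_pair_sq_eq_span_singleton {R : Type*} [CommRing R] {a b s : R}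
    (hs : s ^ 2 = a ^ 2 + b ^ 2) (hab : IsCoprime b (2 * a)) :
    Ideal.span {b, a + s} ^ 2 = Ideal.span {a + s} := by
  have hb : b * b = (a + s) * (s - a) := by linear_combination -hs
  apply le_antisymm
  · rw [sq, Ideal.span_pair_mul_span_pair, Ideal.span_le]
    rintro x (rfl | rfl | rfl | rfl)
    · exact Ideal.mem_span_singleton.mpr ⟨_, hb⟩
    · exact Ideal.mem_span_singleton.mpr ⟨b, by ring⟩
    · exact Ideal.mem_span_singleton.mpr ⟨b, by ring⟩
    · exact Ideal.mem_span_singleton.mpr ⟨a + s, rfl⟩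
  · rw [Ideal.span_singleton_le_iff_mem]
    obtain ⟨x, y, hxy⟩ := hab
    have hb' : b ∈ Ideal.span {b, a + s} := Ideal.subset_span (by simp)
    have hg : a + s ∈ Ideal.span {b, a + s} := Ideal.subset_span (by simp)
    have h : a + s = x * (b * (a + s)) + y * ((a + s) * (a + s) - b * b) := by
      linear_combination (-(a + s)) * hxy - y * hs
    rw [sq]
    have hmem := add_mem (Ideal.mul_mem_left _ x (Ideal.mul_mem_mul hb' hg))
      (Ideal.mul_mem_left _ y (sub_mem (Ideal.mul_mem_mul hg hg) (Ideal.mul_mem_mul hb' hb')))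
    rwa [← h] at hmem

theorem mod_four_eq_one_of_mul_sq_eq_sq_add_sq {D x y z : ℤ} (hD : Squarefree D)
    (hodd : D % 2 = 1) (hx : x ≠ 0) (h : D * x ^ 2 = y ^ 2 + z ^ 2) {p : ℕ} (hp : p.Prime)
    (hpD : (p : ℤ) ∣ D) : p % 4 = 1 := by
  have hp2 : p % 2 = 1 := by
    rcases hp.eq_two_or_odd with rfl | h2
    · omega
    · exact h2
  by_contra hp1
  have hp3 : p % 4 = 3 := by omega
  have : Fact p.Prime := ⟨hp⟩
  have hD0 : D.natAbs ≠ 0 := Int.natAbs_ne_zero.mpr hD.ne_zero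
  have hx0 : x.natAbs ≠ 0 := Int.natAbs_ne_zero.mpr hx
  have hN : D.natAbs * x.natAbs ^ 2 = y.natAbs ^ 2 + z.natAbs ^ 2 := by
    rw [← Int.natAbs_pow, ← Int.natAbs_mul, h]
    zify
    rw [abs_of_nonneg (by positivity)]
    simp
  have hpD' : p ∣ D.natAbs := Int.natCast_dvd.mp hpD
  have heven := Nat.eq_sq_add_sq_iff.mp ⟨_, _, hN⟩ p
    (Nat.mem_primeFactors.mpr ⟨hp, hpD'.mul_right _, by positivity⟩) hp3
  rw [padicValNat.mul hD0 (by positivity), padicValNat.pow, ← Nat.factorization_def _ hp] at heven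
  have h1 := (Int.squarefree_natAbs.mpr hD).natFactorization_le_one p
  have h2 := hp.factorization_pos_of_dvd hD0 hpD'
  rw [show D.natAbs.factorization p = 1 by omega] at heven
  exact absurd heven (by grind)

theorem exists_int_of_rat_mul_sq {D : ℤ} {u v w : ℚ} (hu : u ≠ 0)
    (h : D * u ^ 2 = v ^ 2 + w ^ 2) : ∃ x y z : ℤ, x ≠ 0 ∧ D * x ^ 2 = y ^ 2 + z ^ 2 := by
  have hu' : u.num ≠ 0 := Rat.num_ne_zero.mpr hu
  refine ⟨u.num * v.den * w.den, v.num * u.den * w.den, w.num * u.den * v.den,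
    by simp [hu'], ?_⟩
  rw [← Rat.num_div_den u, ← Rat.num_div_den v, ← Rat.num_div_den w] at h
  field_simp at h
  have h' : (D : ℚ) * (u.num * v.den * w.den) ^ 2 =
      (v.num * u.den * w.den) ^ 2 + (w.num * u.den * v.den) ^ 2 := by
    linear_combination h
  exact_mod_cast h'

theorem exists_sq_add_sq_of_forall_prime_mod_four {D : ℤ} (hD0 : 0 < D) (hD : Squarefree D)
    (hodd : D % 2 = 1) (h : ∀ p : ℕ, p.Prime → (p : ℤ) ∣ D → p % 4 = 1) :
    ∃ a b : ℤ, D = a ^ 2 + b ^ 2 ∧ IsCoprime b (2 * a) := by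
  obtain ⟨x, y, hxy⟩ := Nat.eq_sq_add_sq_of_isSquare_mod_neg_one
    ((ZMod.isSquare_neg_one_iff_forall_mem_primeFactors_mod_four_ne_three
      (Int.squarefree_natAbs.mpr hD)).mpr fun q hq => by
        have := h q (Nat.prime_of_mem_primeFactors hq)
          (Int.natCast_dvd.mpr (Nat.dvd_of_mem_primeFactors hq))
        omega)
  have hxy' : D = (x : ℤ) ^ 2 + (y : ℤ) ^ 2 := by
    zify at hxy
    rwa [abs_of_pos hD0] at hxy
  have hcop : IsCoprime (x : ℤ) y := by
    rw [← gcd_isUnit_iff]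
    apply hD
    rw [hxy', sq, sq]
    exact dvd_add (mul_dvd_mul (gcd_dvd_left _ _) (gcd_dvd_left _ _))
      (mul_dvd_mul (gcd_dvd_right _ _) (gcd_dvd_right _ _))
  have two : ∀ b : ℤ, b % 2 = 1 → IsCoprime b 2 := fun b hb => ⟨1, -(b / 2), by omega⟩
  rcases Int.emod_two_eq_zero_or_one y with hy | hy
  · have hx : (x : ℤ) % 2 = 1 := by
      rcases Int.emod_two_eq_zero_or_one x with hx | hx
      · rw [hxy', Int.add_emod, sq, sq, Int.mul_emod, hx, Int.mul_emod (y : ℤ), hy] at hodd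
        simp at hodd
      · exact hx
    exact ⟨y, x, by rw [hxy']; ring, (two _ hx).mul_right hcop⟩
  · exact ⟨x, y, hxy', (two _ hy).mul_right hcop.symm⟩

/-- Let `D > 1` be square-free with `D ≡ 1 (mod 8)`, `F = ℚ(√D)`,
`𝒪` its ring of integers and `𝔡` the different of `F/ℚ`.  There exist a totally
positive `β ∈ F^×` and a fractional ideal `𝔞` with `(8β)·𝔡 = 𝔞²` if and only if
every prime `p ∣ D` satisfies `p ≡ 1 (mod 4)`. -/
theorem stmt12 (D : ℤ) (hD1 : 1 < D) (hsq : Squarefree D) (hD8 : D % 8 = 1)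
    (F : Type*) [Field F] [NumberField F]
    (sd : F) (hsd : sd ^ 2 = (D : F)) (hadj : Algebra.adjoin ℚ {sd} = ⊤) :
    (∃ β : F, β ≠ 0 ∧ (∀ φ : F →+* ℝ, 0 < φ β) ∧
      ∃ a : FractionalIdeal (𝓞 F)⁰ F, a ≠ 0 ∧
        FractionalIdeal.spanSingleton (𝓞 F)⁰ (8 * β)
            * (differentIdeal ℤ (𝓞 F) : FractionalIdeal (𝓞 F)⁰ F)
          = a ^ 2)
    ↔ (∀ p : ℕ, p.Prime → (p : ℤ) ∣ D → p % 4 = 1) := by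
  have hD0 : (0 : ℝ) < D := by exact_mod_cast (by omega : 0 < D)
  have hsdint : IsIntegral ℤ sd := IsIntegral.of_pow two_pos (hsd ▸ isIntegral_intCast D)
  let s : 𝓞 F := ⟨sd, hsdint⟩
  have hs : algebraMap (𝓞 F) F s = sd := rfl
  have hs2 : s ^ 2 = (D : 𝓞 F) := by
    apply FaithfulSMul.algebraMap_injective (𝓞 F) F
    rw [map_pow, hs, hsd, map_intCast]
  have hsd0 : sd ≠ 0 := by
    rintro rfl
    have : D = 0 := by exact_mod_cast (by simpa using hsd.symm : (D : F) = 0)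
    omega
  rw [differentIdeal_eq_span_sqrt hD1 hsq (by omega) hadj hs hs2]
  simp only [FractionalIdeal.coeIdeal_span_singleton, hs,
    FractionalIdeal.spanSingleton_mul_spanSingleton]
  constructor
  · rintro ⟨β, -, hpos, a, -, ha⟩ p hp hpD
    obtain ⟨u, v, rfl⟩ := exists_rat_coords hD1 hsq hsd hadj β
    have hN : 0 < u ^ 2 - D * v ^ 2 := by
      obtain ⟨φ, hφ⟩ := exists_ringHom_real hD1 hsq hsd hadj (Real.sq_sqrt hD0.le)
      obtain ⟨ψ, hψ⟩ := exists_ringHom_real hD1 hsq hsd hadj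
        (r := -√D) (by rw [neg_sq, Real.sq_sqrt hD0.le])
      have h := mul_pos (hpos φ) (hpos ψ)
      simp only [map_add, map_mul, map_ratCast, hφ, hψ] at h
      have h' : (0 : ℝ) < u ^ 2 - D * v ^ 2 := by
        rw [← Real.sq_sqrt hD0.le]
        linarith
      exact_mod_cast h'
    have habs := congrArg FractionalIdeal.absNorm ha
    rw [FractionalIdeal.absNorm_span_singleton, map_pow,
      show 8 * ((u : F) + v * sd) * sd = ((8 * D * v : ℚ) : F) + ((8 * u : ℚ) : F) * sd by
        push_cast; linear_combination 8 * (v : F) * hsd,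
      norm_rat_coords hD1 hsq hsd hadj] at habs
    set r := FractionalIdeal.absNorm a
    have hDq : (0 : ℚ) < D := by exact_mod_cast (by omega : 0 < D)
    have hr : 64 * D * (u ^ 2 - D * v ^ 2) = r ^ 2 := by
      rw [← habs, abs_of_neg (by nlinarith [mul_pos hDq hN])]
      ring
    have hu : u ≠ 0 := by
      rintro rfl
      nlinarith [mul_nonneg hDq.le (sq_nonneg v)]
    obtain ⟨x, y, z, hx, hxyz⟩ := exists_int_of_rat_mul_sq (D := D) (v := D * v) (w := r / 8) hu
      (by linear_combination hr / 64)
    exact mod_four_eq_one_of_mul_sq_eq_sq_add_sq hsq (by omega) hx hxyz hp hpD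
  · intro h
    obtain ⟨a, b, hab, hcop⟩ := exists_sq_add_sq_of_forall_prime_mod_four (by omega) hsq
      (by omega) h
    have hb : b ≠ 0 := by
      rintro rfl
      exact Squarefree.rat_sq_ne hD1 hsq a (by rw [hab]; push_cast; ring)
    have hpos : ∀ φ : F →+* ℝ, 0 < φ ((a + sd) / (8 * sd)) := by
      intro φ
      have hφ : φ sd ^ 2 = a ^ 2 + b ^ 2 := by
        rw [← map_pow, hsd, hab]; simp
      have hφ0 : φ sd ≠ 0 := (map_ne_zero φ).mpr hsd0
      have hb2 : (0 : ℝ) < b ^ 2 := by positivity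
      have hlt : (a : ℝ) ^ 2 < φ sd ^ 2 := by linarith
      have hnum : 0 < (a + φ sd) * φ sd := by
        nlinarith [sq_nonneg (a + φ sd)]
      have : φ ((a + sd) / (8 * sd)) = (a + φ sd) * φ sd / (8 * φ sd ^ 2) := by
        simp only [map_div₀, map_add, map_mul, map_intCast, map_ofNat]
        field_simp
      rw [this]
      positivity
    have hcopF : IsCoprime (b : 𝓞 F) (2 * a) := by
      simpa using hcop.map (Int.castRingHom (𝓞 F))
    have hJ := span_pair_sq_eq_span_singleton (s := s)
      (by rw [hs2, hab]; push_cast; ring) hcopF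
    obtain ⟨φ, -⟩ := exists_ringHom_real hD1 hsq hsd hadj (Real.sq_sqrt hD0.le)
    refine ⟨(a + sd) / (8 * sd), fun h0 => ?_, hpos,
      (Ideal.span {(b : 𝓞 F), a + s} : Ideal (𝓞 F)), ?_, ?_⟩
    · simpa [h0] using hpos φ
    · rw [FractionalIdeal.coeIdeal_ne_zero]
      intro h0
      have hb0 : (b : 𝓞 F) ∈ Ideal.span {(b : 𝓞 F), a + s} := Ideal.subset_span (by simp)
      rw [h0] at hb0
      exact hb (by exact_mod_cast (Ideal.mem_bot.mp hb0))
    · rw [← FractionalIdeal.coeIdeal_pow, hJ, FractionalIdeal.coeIdeal_span_singleton,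
        map_add, hs, map_intCast]
      congr 1
      field_simp
end
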